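/- Let A be a Coxeter arrangement with Coxeter group W, let ω ∈ Ω(A,∞)^W be a nonzero W-invariant logarithmic 1-form and α ∈ V* with ker(α) ∈ A. Then ord_α(I*(ω, dα)) ≠ 0; that is, the rational function I*(ω, dα) either has a pole along ker(α) or vanishes along ker(α). -/

import Mathlib

open MvPolynomial

noncomputable section CoxeterFormalization

/-! ### The ambient rings: `S = Sym(V*)`, `F = Frac(S)`, rational 1-forms.

We model the `ℓ`-dimensional Euclidean space `V` as `ℝ^ℓ` with its standard
(orthonormal) coordinates, so that `S = ℝ[x_0, …, x_{ℓ-1}]`, and a rational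
differential 1-form `ω = Σ ω_x dx_x` (equivalently, a rational derivation
`ξ = Σ ξ_x ∂_x`) is recorded by its component vector `(ω_x)_x : Fin ℓ → F`. -/

abbrev Spoly (ℓ : ℕ) := MvPolynomial (Fin ℓ) ℝ
abbrev Ffield (ℓ : ℕ) := FractionRing (Spoly ℓ)
abbrev OmF (ℓ : ℕ) := Fin ℓ → Ffield ℓ

variable {ℓ t : ℕ}

/-- The image of `S` in `F`: the "regular" (polynomial) rational functions. -/
def Sreg (ℓ : ℕ) : Set (Ffield ℓ) := Set.range (algebraMap (Spoly ℓ) (Ffield ℓ))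

def toF (p : Spoly ℓ) : Ffield ℓ := algebraMap (Spoly ℓ) (Ffield ℓ) p

/-- The linear form `α = Σ a_x · x_x ∈ V*` attached to a normal vector `a`. -/
def linForm (a : Fin ℓ → ℝ) : Spoly ℓ := ∑ x, MvPolynomial.C (a x) * MvPolynomial.X x

def linF (a : Fin ℓ → ℝ) : Ffield ℓ := toF (linForm a)

def cF (r : ℝ) : Ffield ℓ := toF (MvPolynomial.C r)

def XF (x : Fin ℓ) : Ffield ℓ := toF (MvPolynomial.X x)

/-- `Q = ∏_{H ∈ A} α_H`, as an element of `F`. -/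
def QF (A : Finset (Fin ℓ → ℝ)) : Ffield ℓ := toF (∏ a ∈ A, linForm a)

/-- `Q^m = ∏_{H ∈ A} α_H^{m(H)}` for an integral multiplicity `m`. -/
def QmF (A : Finset (Fin ℓ → ℝ)) (m : (Fin ℓ → ℝ) → ℤ) : Ffield ℓ :=
  ∏ a ∈ A, linF a ^ m a

/-- Ziegler's module `Ω(A,∞)` of logarithmic 1-forms:
`Q^N ω` and `(Q/α_H)^N dα_H ∧ ω` regular for `N ≫ 0`.  The wedge
`dα_H ∧ ω` is recorded by its components `a_x ω_y - a_y ω_x`. -/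
def OmegaInf (A : Finset (Fin ℓ → ℝ)) : Set (OmF ℓ) :=
  {ω | ∃ N : ℕ,
    (∀ x, QF A ^ N * ω x ∈ Sreg ℓ) ∧
    ∀ a ∈ A, ∀ x y,
      (QF A / linF a) ^ N * (cF (a x) * ω y - cF (a y) * ω x) ∈ Sreg ℓ}

/-- `Ω(A,m)` for an arbitrary multiplicity `m : A → ℤ`: those `ω ∈ Ω(A,∞)` with
`(Q/α_H)^N α_H^{m(H)} I*(dα_H, ω) ∈ S` for `N ≫ 0`; here
`I*(dα_H, ω) = Σ_x a_x ω_x` (the coordinates are orthonormal). -/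
def OmegaMult (A : Finset (Fin ℓ → ℝ)) (m : (Fin ℓ → ℝ) → ℤ) : Set (OmF ℓ) :=
  {ω ∈ OmegaInf A | ∃ N : ℕ,
    ∀ a ∈ A, (QF A / linF a) ^ N * linF a ^ m a * (∑ x, cF (a x) * ω x) ∈ Sreg ℓ}

/-! ### The action of `GL_ℓ(ℝ)` on `S`, `F` and on component vectors. -/

/-- Substitution `x_i ↦ Σ_j M_{i j} x_j`, i.e. `f ↦ f ∘ M`. -/
def matSub (M : Matrix (Fin ℓ) (Fin ℓ) ℝ) : Spoly ℓ →ₐ[ℝ] Spoly ℓ :=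
  MvPolynomial.aeval fun x => ∑ y, MvPolynomial.C (M x y) * MvPolynomial.X y

lemma matSub_comp (M N : Matrix (Fin ℓ) (Fin ℓ) ℝ) :
    (matSub M).comp (matSub N) = matSub (N * M) := by
  apply MvPolynomial.algHom_ext
  intro x
  simp only [matSub, AlgHom.coe_comp, Function.comp_apply, aeval_X, map_sum, map_mul, aeval_C,
    Matrix.mul_apply, C_mul, Finset.sum_mul, Finset.mul_sum, MvPolynomial.algebraMap_eq,
    mul_assoc]
  rw [Finset.sum_comm]

lemma matSub_one : matSub (1 : Matrix (Fin ℓ) (Fin ℓ) ℝ) = AlgHom.id ℝ (Spoly ℓ) := by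
  apply MvPolynomial.algHom_ext
  intro x
  simp [matSub, Matrix.one_apply, apply_ite MvPolynomial.C, ite_mul, Finset.sum_ite_eq]

lemma matSub_injective (g : Matrix.GeneralLinearGroup (Fin ℓ) ℝ) :
    Function.Injective (matSub (↑g : Matrix (Fin ℓ) (Fin ℓ) ℝ)) := by
  intro p q h
  have h3 : (matSub (↑g⁻¹ : Matrix (Fin ℓ) (Fin ℓ) ℝ)).comp
      (matSub (↑g : Matrix (Fin ℓ) (Fin ℓ) ℝ)) = AlgHom.id ℝ (Spoly ℓ) := by
    rw [matSub_comp]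
    have h1 : ((↑g : Matrix (Fin ℓ) (Fin ℓ) ℝ) * (↑g⁻¹ : Matrix (Fin ℓ) (Fin ℓ) ℝ))
        = (1 : Matrix (Fin ℓ) (Fin ℓ) ℝ) := by
      rw [← Units.val_mul]; simp
    rw [h1, matSub_one]
  have h2 := congrArg (matSub (↑g⁻¹ : Matrix (Fin ℓ) (Fin ℓ) ℝ)) h
  rwa [← AlgHom.comp_apply, ← AlgHom.comp_apply, h3, AlgHom.id_apply, AlgHom.id_apply] at h2

/-- The action of `g ∈ GL_ℓ(ℝ)` on rational functions, `f ↦ f ∘ g⁻¹`. -/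
def fAct (g : Matrix.GeneralLinearGroup (Fin ℓ) ℝ) : Ffield ℓ →+* Ffield ℓ :=
  IsFractionRing.lift (g :=
    (algebraMap (Spoly ℓ) (Ffield ℓ)).comp
      (matSub (↑g⁻¹ : Matrix (Fin ℓ) (Fin ℓ) ℝ)).toRingHom)
    ((IsFractionRing.injective (Spoly ℓ) (Ffield ℓ)).comp (matSub_injective g⁻¹))

/-- The natural action of an **orthogonal** `g` on the component vector of a
differential 1-form (equivalently, of a derivation): `(g·v)_x = Σ_y g_{x y} · g(v_y)`. -/
def vecAct (g : Matrix.GeneralLinearGroup (Fin ℓ) ℝ) (v : OmF ℓ) : OmF ℓ :=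
  fun x => ∑ y, cF ((↑g : Matrix (Fin ℓ) (Fin ℓ) ℝ) x y) * fAct g (v y)

/-- `W`-invariant component vectors (1-forms/derivations). -/
def InvVec (W : Subgroup (Matrix.GeneralLinearGroup (Fin ℓ) ℝ)) : Set (OmF ℓ) :=
  {ω | ∀ g ∈ W, vecAct g ω = ω}

/-- `Ω(A,∞)^W`. -/
def OmegaInfW (A : Finset (Fin ℓ → ℝ)) (W : Subgroup (Matrix.GeneralLinearGroup (Fin ℓ) ℝ)) :
    Set (OmF ℓ) := OmegaInf A ∩ InvVec W

/-- `Ω(A,m)^W = Ω(A,m) ∩ Ω(A,∞)^W`. -/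
def OmegaMultW (A : Finset (Fin ℓ → ℝ)) (W : Subgroup (Matrix.GeneralLinearGroup (Fin ℓ) ℝ))
    (m : (Fin ℓ → ℝ) → ℤ) : Set (OmF ℓ) := OmegaMult A m ∩ InvVec W

/-- `W`-invariant polynomials. -/
def InvPoly (W : Subgroup (Matrix.GeneralLinearGroup (Fin ℓ) ℝ)) : Set (Spoly ℓ) :=
  {p | ∀ g ∈ W, matSub (↑g : Matrix (Fin ℓ) (Fin ℓ) ℝ) p = p}

/-- The invariant ring `R = S^W`, viewed inside `F`. -/
def RF (W : Subgroup (Matrix.GeneralLinearGroup (Fin ℓ) ℝ)) : Set (Ffield ℓ) :=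
  toF '' InvPoly W

/-- The orthogonal reflection through the hyperplane `ker⟨a, ·⟩`. -/
def reflMat (a : Fin ℓ → ℝ) : Matrix (Fin ℓ) (Fin ℓ) ℝ :=
  1 - (2 / ∑ x, a x * a x) • Matrix.vecMulVec a a

/-! ### Block (irreducible-factor) structure. -/

/-- A polynomial involving only the variables of the block `i` (w.r.t. the block
assignment `blk : Fin ℓ → Fin t`). -/
def blockPoly (blk : Fin ℓ → Fin t) (i : Fin t) (p : Spoly ℓ) : Prop :=
  ∀ m ∈ p.support, ∀ x ∈ Finsupp.support m, blk x = i

/-- Rational functions in the variables of block `i` only. -/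
def blockFrac (blk : Fin ℓ → Fin t) (i : Fin t) : Set (Ffield ℓ) :=
  {y | ∃ p q : Spoly ℓ, blockPoly blk i p ∧ blockPoly blk i q ∧ q ≠ 0 ∧ y * toF q = toF p}

/-- A component vector belonging to the factor `V[i]`:  components outside block `i`
vanish and all components are rational functions of the block-`i` variables. -/
def BlockVec (blk : Fin ℓ → Fin t) (i : Fin t) (ω : OmF ℓ) : Prop :=
  (∀ x, blk x ≠ i → ω x = 0) ∧ ∀ x, ω x ∈ blockFrac blk i

/-- All the data of a (not necessarily irreducible) Coxeter arrangement `A` in the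
Euclidean space `V = ℝ^ℓ`, together with its decomposition into `t` irreducible
factors and a system of basic invariants:

* `A` is a finite set of hyperplanes, recorded by nonzero defining normal vectors,
  pairwise non-proportional;
* `W` is a finite subgroup of `GL_ℓ(ℝ)` consisting of orthogonal transformations,
  generated by the reflections through the members of `A`, and `A` is exactly the
  set of reflecting hyperplanes of `W` (so `A` is the Coxeter arrangement of the
  finite real reflection group `W`);
* `blk` assigns to every coordinate its irreducible block `V[i]`, every hyperplane
  of `A` lies over a single block;
* `P c` (`c : Fin ℓ`) are basic invariants: homogeneous, `W`-invariant,
  algebraically independent generators of `R = S^W`, the invariants of the block `i`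
  being those `P c` with `blk c = i` and involving only block-`i` variables;
* within each block `i` the invariant `P (top i)` has strictly largest degree
  (this uses irreducibility of the factors; it makes the primitive derivations
  `D[i] = ∂/∂P_{ℓ[i]}[i]` well defined up to constants). -/
structure CoxeterSetup (ℓ t : ℕ) where
  A : Finset (Fin ℓ → ℝ)
  W : Subgroup (Matrix.GeneralLinearGroup (Fin ℓ) ℝ)
  hA0 : ∀ a ∈ A, a ≠ 0
  hAprop : ∀ a ∈ A, ∀ b ∈ A, (∃ c : ℝ, a = c • b) → a = b
  hWfin : (W : Set (Matrix.GeneralLinearGroup (Fin ℓ) ℝ)).Finite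
  hWorth : ∀ g ∈ W, Matrix.transpose (↑g : Matrix (Fin ℓ) (Fin ℓ) ℝ) * (↑g : Matrix (Fin ℓ) (Fin ℓ) ℝ) = 1
  hrefl : ∀ a ∈ A, ∃ g ∈ W, (↑g : Matrix (Fin ℓ) (Fin ℓ) ℝ) = reflMat a
  hhyp : ∀ g ∈ W, ∀ a : Fin ℓ → ℝ, a ≠ 0 → (↑g : Matrix (Fin ℓ) (Fin ℓ) ℝ) = reflMat a →
    ∃ b ∈ A, ∃ c : ℝ, a = c • b
  hgen : W = Subgroup.closure
    {g : Matrix.GeneralLinearGroup (Fin ℓ) ℝ | ∃ a ∈ A, (↑g : Matrix (Fin ℓ) (Fin ℓ) ℝ) = reflMat a}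
  blk : Fin ℓ → Fin t
  hblkA : ∀ a ∈ A, ∃ i, ∀ x, a x ≠ 0 → blk x = i
  P : Fin ℓ → MvPolynomial (Fin ℓ) ℝ
  deg : Fin ℓ → ℕ
  hdeg : ∀ c, 0 < deg c
  hPhom : ∀ c, (P c).IsHomogeneous (deg c)
  hPblock : ∀ c, blockPoly blk (blk c) (P c)
  hPinv : ∀ c, P c ∈ InvPoly W
  hPind : AlgebraicIndependent ℝ P
  hPgen : ∀ p : Spoly ℓ, p ∈ InvPoly W ↔ p ∈ Algebra.adjoin ℝ (Set.range P)
  top : Fin t → Fin ℓ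
  htop : ∀ i, blk (top i) = i
  htopdeg : ∀ i c, blk c = i → c ≠ top i → deg c < deg (top i)

/-! ### Primitive derivations and the connection `∇_D`. -/

/-- The covariant derivative `∇_D` on rational 1-forms: since `∇_D (dx_x) = 0`,
it acts componentwise, `∇_D(Σ f_x dx_x) = Σ D(f_x) dx_x`. -/
def nabVec (D : Derivation ℝ (Ffield ℓ) (Ffield ℓ)) (ω : OmF ℓ) : OmF ℓ :=
  fun x => D (ω x)

/-- `T = ker (D : R → R)`, viewed inside `F`. -/
def TF (W : Subgroup (Matrix.GeneralLinearGroup (Fin ℓ) ℝ))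
    (D : Derivation ℝ (Ffield ℓ) (Ffield ℓ)) : Set (Ffield ℓ) :=
  {y ∈ RF W | D y = 0}

/-- The differential `dP` of a polynomial, as a component vector: `(dP)_x = ∂P/∂x_x`. -/
def dPoly (p : Spoly ℓ) : OmF ℓ := fun x => toF (MvPolynomial.pderiv x p)

/-! ### Freeness of a submodule over a subring of coefficients. -/

/-- `v : ι → M` is a basis of the sub-`C`-module `Mod ⊆ M` over the coefficient
set `C ⊆ F`: the members of the family lie in `Mod`, every element of `Mod`
is a finite `C`-linear combination of them, and they are linearly independent
over `C`. -/
def IsBasisOver {ℓ : ℕ} {ι M : Type*} [AddCommMonoid M] [Module (Ffield ℓ) M]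
    (C : Set (Ffield ℓ)) (Mod : Set M) (v : ι → M) : Prop :=
  (∀ j, v j ∈ Mod) ∧
  (∀ ω ∈ Mod, ∃ c : ι →₀ Ffield ℓ, (∀ j, c j ∈ C) ∧ ω = c.sum fun j a => a • v j) ∧
  (∀ c : ι →₀ Ffield ℓ, (∀ j, c j ∈ C) → (c.sum fun j a => a • v j) = 0 → c = 0)

/-! ### Order of poles along a hyperplane. -/

/-- The localization `S_{(α)}` of `S` at the prime ideal `(α)`, viewed in `F`:
fractions with denominator prime to `α`. -/
def Sloc (a : Fin ℓ → ℝ) : Set (Ffield ℓ) :=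
  {y | ∃ p q : Spoly ℓ, ¬ linForm a ∣ q ∧ y * toF q = toF p}

/-- `ordEq a f k` says `ord_α(f) = k`, i.e. `k = min {j : α^j f ∈ S_{(α)}}`. -/
def ordEq (a : Fin ℓ → ℝ) (f : Ffield ℓ) (k : ℤ) : Prop :=
  linF a ^ k * f ∈ Sloc a ∧ ∀ j : ℤ, linF a ^ j * f ∈ Sloc a → k ≤ j

/-! ### Logarithmic derivation modules. -/

/-- The module `D(A,−∞)` of logarithmic derivations (Definition 4.1):
`Q^N ξ` regular and `(Q/α_H)^N ξ(β)` regular whenever `β ⊥ α_H`. -/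
def DerInf (A : Finset (Fin ℓ → ℝ)) : Set (Derivation ℝ (Ffield ℓ) (Ffield ℓ)) :=
  {ξ | ∃ N : ℕ,
    (∀ x, QF A ^ N * ξ (XF x) ∈ Sreg ℓ) ∧
    ∀ a ∈ A, ∀ b : Fin ℓ → ℝ, (∑ x, a x * b x) = 0 →
      (QF A / linF a) ^ N * ξ (linF b) ∈ Sreg ℓ}

/-- `D(A,m)` for a multiplicity `m : A → ℤ`:
`(Q/α_H)^N ξ(α_H) ∈ α_H^{m(H)} S` for `N ≫ 0`. -/
def DerMult (A : Finset (Fin ℓ → ℝ)) (m : (Fin ℓ → ℝ) → ℤ) :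
    Set (Derivation ℝ (Ffield ℓ) (Ffield ℓ)) :=
  {ξ ∈ DerInf A | ∃ N : ℕ, ∀ a ∈ A, ∃ p : Spoly ℓ,
    (QF A / linF a) ^ N * ξ (linF a) = linF a ^ m a * toF p}

/-- The component vector of a derivation: `ξ = Σ_x ξ(x_x) ∂_x`. -/
def derVec (ξ : Derivation ℝ (Ffield ℓ) (Ffield ℓ)) : OmF ℓ := fun x => ξ (XF x)

/-- `W`-invariant derivations (via the action on component vectors; the group
consists of orthogonal transformations). -/
def InvDer (W : Subgroup (Matrix.GeneralLinearGroup (Fin ℓ) ℝ)) :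
    Set (Derivation ℝ (Ffield ℓ) (Ffield ℓ)) :=
  {ξ | ∀ g ∈ W, vecAct g (derVec ξ) = derVec ξ}

/-- `D(A,−∞)^W`. -/
def DerInfW (A : Finset (Fin ℓ → ℝ)) (W : Subgroup (Matrix.GeneralLinearGroup (Fin ℓ) ℝ)) :
    Set (Derivation ℝ (Ffield ℓ) (Ffield ℓ)) := DerInf A ∩ InvDer W

/-- `D(A,m)^W = D(A,m) ∩ D(A,−∞)^W`. -/
def DerMultW (A : Finset (Fin ℓ → ℝ)) (W : Subgroup (Matrix.GeneralLinearGroup (Fin ℓ) ℝ))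
    (m : (Fin ℓ → ℝ) → ℤ) : Set (Derivation ℝ (Ffield ℓ) (Ffield ℓ)) :=
  DerMult A m ∩ InvDer W

/-- `I* : Ω_F → Der_F`, `I*(ω)(f) = I*(ω, df) = Σ_x ω_x ∂f/∂x_x`, defined using a
family `pd` of partial-derivative derivations of `F`. -/
def IstarDer (pd : Fin ℓ → Derivation ℝ (Ffield ℓ) (Ffield ℓ)) (ω : OmF ℓ) :
    Derivation ℝ (Ffield ℓ) (Ffield ℓ) :=
  ∑ x, ω x • pd x

/-- The covariant derivative `∇_D` on rational derivations: `(∇_D ξ)(α) = D(ξ(α))`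
for `α ∈ V*`, i.e. `∇_D ξ = Σ_x D(ξ(x_x)) ∂_x`. -/
def nabDer (pd : Fin ℓ → Derivation ℝ (Ffield ℓ) (Ffield ℓ))
    (D : Derivation ℝ (Ffield ℓ) (Ffield ℓ))
    (ξ : Derivation ℝ (Ffield ℓ) (Ffield ℓ)) : Derivation ℝ (Ffield ℓ) (Ffield ℓ) :=
  ∑ x, D (ξ (XF x)) • pd x

end CoxeterFormalization

section Reflections

variable {ℓ : ℕ}

lemma reflMat_smul {c : ℝ} (hc : c ≠ 0) (b : Fin ℓ → ℝ) : reflMat (c • b) = reflMat b := by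
  have h : ∑ x, (c • b) x * (c • b) x = c ^ 2 * ∑ x, b x * b x := by
    rw [Finset.mul_sum]
    exact Finset.sum_congr rfl fun x _ => by simp only [Pi.smul_apply, smul_eq_mul]; ring
  ext i j
  rw [reflMat, h, reflMat]
  generalize ∑ x, b x * b x = n
  simp only [Matrix.sub_apply, Matrix.smul_apply, Matrix.vecMulVec_apply, Pi.smul_apply,
    smul_eq_mul]
  field_simp

lemma reflMat_transpose (a : Fin ℓ → ℝ) : (reflMat a).transpose = reflMat a := by
  ext i j
  simp [reflMat, Matrix.vecMulVec_apply, Matrix.one_apply, eq_comm, mul_comm]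

lemma sum_mul_reflMat {a : Fin ℓ → ℝ} (ha : a ≠ 0) (y : Fin ℓ) :
    ∑ x, a x * reflMat a x y = -a y := by
  have hs : ∑ x, a x * a x ≠ 0 := fun h => ha (dotProduct_self_eq_zero.mp h)
  have h : ∀ x, a x * reflMat a x y =
      a x * (1 : Matrix (Fin ℓ) (Fin ℓ) ℝ) x y - (2 / ∑ z, a z * a z) * a y * (a x * a x) := by
    intro x
    simp only [reflMat, Matrix.sub_apply, Matrix.smul_apply, Matrix.vecMulVec_apply, smul_eq_mul]
    ring
  simp only [h, Finset.sum_sub_distrib, ← Finset.mul_sum]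
  simp only [Matrix.one_apply, mul_ite, mul_one, mul_zero, Finset.sum_ite_eq', Finset.mem_univ,
    if_true]
  rw [mul_right_comm, div_mul_cancel₀ _ hs]
  ring

lemma linForm_ne_zero {a : Fin ℓ → ℝ} (ha : a ≠ 0) : linForm a ≠ 0 := by
  intro h
  have h1 : MvPolynomial.eval a (linForm a) = 0 := by rw [h, map_zero]
  simp only [linForm, map_sum, map_mul, eval_C, eval_X] at h1
  exact ha (dotProduct_self_eq_zero.mp h1)

lemma linForm_prime {a : Fin ℓ → ℝ} (ha : a ≠ 0) : Prime (linForm a) := by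
  obtain ⟨i, hi⟩ := Function.ne_iff.mp ha
  let c : Fin ℓ →₀ ℝ := Finsupp.equivFunOnFinite.symm a
  have hc : linForm a = sumSMulX c := by
    rw [sumSMulX, Finsupp.linearCombination_apply, Finsupp.sum_fintype _ _ (by simp)]
    simp [linForm, c, MvPolynomial.smul_eq_C_mul]
  rw [hc]
  refine (irreducible_sumSMulX c ⟨i, by simpa [c] using hi⟩ fun r hr => ?_).prime
  exact isUnit_of_dvd_unit (hr i) (isUnit_iff_ne_zero.mpr hi)

/-- A reflection acts trivially on functions restricted to its hyperplane. -/
lemma linForm_dvd_matSub_reflMat_sub (a : Fin ℓ → ℝ) (p : Spoly ℓ) :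
    linForm a ∣ matSub (reflMat a) p - p := by
  rw [← Ideal.mem_span_singleton, ← Ideal.Quotient.eq]
  suffices h : (Ideal.Quotient.mkₐ ℝ (Ideal.span {linForm a})).comp (matSub (reflMat a)) =
      Ideal.Quotient.mkₐ ℝ (Ideal.span {linForm a}) from DFunLike.congr_fun h p
  apply MvPolynomial.algHom_ext
  intro x
  simp only [AlgHom.comp_apply, Ideal.Quotient.mkₐ_eq_mk]
  rw [Ideal.Quotient.eq, Ideal.mem_span_singleton]
  refine ⟨-C (2 / (∑ z, a z * a z) * a x), ?_⟩
  simp only [matSub, aeval_X, linForm, reflMat, Matrix.sub_apply, Matrix.smul_apply,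
    Matrix.vecMulVec_apply, smul_eq_mul, C_sub, sub_mul, Finset.sum_sub_distrib]
  have h1 : ∑ y, C ((1 : Matrix (Fin ℓ) (Fin ℓ) ℝ) x y) * X y = (X x : Spoly ℓ) := by
    simp [Matrix.one_apply, apply_ite C, ite_mul]
  rw [h1, sub_sub_cancel_left, mul_neg, Finset.sum_mul, neg_inj]
  refine Finset.sum_congr rfl fun y _ => ?_
  simp only [C_mul]
  ring

lemma fAct_toF (g : Matrix.GeneralLinearGroup (Fin ℓ) ℝ) (p : Spoly ℓ) :
    fAct g (toF p) = toF (matSub (↑g⁻¹ : Matrix (Fin ℓ) (Fin ℓ) ℝ) p) :=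
  IsFractionRing.lift_algebraMap _ p

lemma fAct_cF (g : Matrix.GeneralLinearGroup (Fin ℓ) ℝ) (r : ℝ) : fAct g (cF r) = cF r := by
  rw [cF, fAct_toF]
  exact congrArg toF ((matSub _).commutes r)

/-- The component along `a` of a vector fixed by the reflection in `a` is anti-invariant. -/
lemma fAct_sum_eq_neg {g : Matrix.GeneralLinearGroup (Fin ℓ) ℝ} {a : Fin ℓ → ℝ} (ha : a ≠ 0)
    (hg : (↑g : Matrix (Fin ℓ) (Fin ℓ) ℝ) = reflMat a) {ω : OmF ℓ} (hω : vecAct g ω = ω) :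
    fAct g (∑ x, cF (a x) * ω x) = -∑ x, cF (a x) * ω x := by
  let φ : ℝ →+* Ffield ℓ := (algebraMap (Spoly ℓ) (Ffield ℓ)).comp MvPolynomial.C
  have hφ : ∀ r, cF r = φ r := fun _ => rfl
  have h : ∑ x, cF (a x) * ω x = -∑ y, cF (a y) * fAct g (ω y) := by
    conv_lhs => rw [← hω]
    simp only [vecAct, hg, Finset.mul_sum]
    rw [Finset.sum_comm, ← Finset.sum_neg_distrib]
    refine Finset.sum_congr rfl fun y _ => ?_
    simp only [← mul_assoc, ← Finset.sum_mul, hφ, ← map_mul, ← map_sum]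
    rw [sum_mul_reflMat ha, map_neg, neg_mul]
  rw [h, neg_neg, ← h]
  simp only [map_sum, map_mul, fAct_cF]

/-- An anti-invariant function without pole along `ker a` vanishes there. -/
lemma not_ordEq_zero_of_fAct_eq_neg {g : Matrix.GeneralLinearGroup (Fin ℓ) ℝ} {a : Fin ℓ → ℝ}
    (ha : a ≠ 0) (hg : (↑g⁻¹ : Matrix (Fin ℓ) (Fin ℓ) ℝ) = reflMat a) {f : Ffield ℓ}
    (hf : fAct g f = -f) : ¬ ordEq a f 0 := by
  rintro ⟨⟨p, q, hq, hpq⟩, hmin⟩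
  rw [zpow_zero, one_mul] at hpq
  have hσ := congrArg (fAct g) hpq
  rw [map_mul, hf, fAct_toF, fAct_toF, hg] at hσ
  set σ := matSub (reflMat a)
  have hpoly : -(p * σ q) = q * σ p := by
    apply IsFractionRing.injective (Spoly ℓ) (Ffield ℓ)
    rw [map_neg, map_mul, map_mul]
    change -(toF p * toF (σ q)) = toF q * toF (σ p)
    rw [← hpq, ← hσ]
    ring
  obtain ⟨u, hu⟩ := linForm_dvd_matSub_reflMat_sub a p
  obtain ⟨v, hv⟩ := linForm_dvd_matSub_reflMat_sub a q
  have h2 : linForm a ∣ C 2 * (p * q) := by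
    refine ⟨-(p * v) - q * u, ?_⟩
    have hC : (C 2 : Spoly ℓ) = 2 := map_ofNat C 2
    rw [hC]
    linear_combination -hpoly - p * hv - q * hu
  have h3 : linForm a ∣ p * q := by
    have h4 := h2.mul_left (C (1 / 2))
    rwa [← mul_assoc, ← C_mul, one_div, inv_mul_cancel₀ two_ne_zero, C_1, one_mul] at h4
  obtain ⟨r, hr⟩ := ((linForm_prime ha).dvd_or_dvd h3).resolve_right hq
  have h5 := hmin (-1) ⟨r, q, hq, by
    have hl : linF a ≠ 0 := by
      simpa [linF, toF] using linForm_ne_zero ha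
    rw [mul_assoc, hpq, hr, zpow_neg_one, inv_mul_eq_div, div_eq_iff hl, mul_comm]
    exact map_mul (algebraMap (Spoly ℓ) (Ffield ℓ)) _ _⟩
  omega

end Reflections

section Statements

variable {ℓ t : ℕ}

/-- equation (2.1) in the proof of Theorem 1.3: for a nonzero
`W`-invariant logarithmic form `ω` and `ker α ∈ A`, `ord_α I*(ω, dα) ≠ 0`. -/
theorem stmt11 (cox : CoxeterSetup ℓ t) :
    ∀ ω ∈ OmegaInfW cox.A cox.W, ω ≠ 0 →
      ∀ a : Fin ℓ → ℝ, a ≠ 0 → (∃ b ∈ cox.A, ∃ c : ℝ, a = c • b) →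
        ¬ ordEq a (∑ x, cF (a x) * ω x) 0 := by
  rintro ω ⟨-, hω⟩ - a ha ⟨b, hb, c, rfl⟩
  have hc : c ≠ 0 := fun h => ha (by rw [h, zero_smul])
  obtain ⟨g, hgW, hg⟩ := cox.hrefl b hb
  rw [← reflMat_smul hc] at hg
  have horth := cox.hWorth g hgW
  rw [hg, reflMat_transpose] at horth
  refine not_ordEq_zero_of_fAct_eq_neg ha ?_ (fAct_sum_eq_neg ha hg (hω g hgW))
  rw [Matrix.coe_units_inv, hg]
  exact Matrix.inv_eq_left_inv horth

end Statements
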